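/- arXiv:2503.01467 — 4 statements merged into one kernel-verified Lean document; each statement's English description precedes it below -/
import Mathlib

section
/- Let N ∈ GL(n,2) be a matrix whose set of essential indices has cardinality m ≤ n. Then there exist a matrix M ∈ GL(m,2) and a permutation σ ∈ S_n such that φ_{m,n}(M) = σ·N, where σ acts by simultaneous permutation of rows and columns. -/
/-- The embedding of an `m × m` matrix over `𝔽₂` into the upper-left corner of an
`n × n` matrix, with the identity in the lower-right block and zeros elsewhere. -/
def embedMat (m n : ℕ) (M : Matrix (Fin m) (Fin m) (ZMod 2)) :
    Matrix (Fin n) (Fin n) (ZMod 2) :=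
  fun i j =>
    if hi : (i : ℕ) < m then
      if hj : (j : ℕ) < m then M ⟨i, hi⟩ ⟨j, hj⟩ else 0
    else if i = j then 1 else 0

/-- The set of essential indices of a matrix: `i` is essential if some off-diagonal
entry in row `i` or column `i` equals `1`. -/
def essential {k : ℕ} (M : Matrix (Fin k) (Fin k) (ZMod 2)) : Set (Fin k) :=
  {i | ∃ j, j ≠ i ∧ (M i j = 1 ∨ M j i = 1)}

/-- The action of a permutation `σ` on a matrix by simultaneous permutation of rows
and columns: `(σ · M) i j = M (σ⁻¹ i) (σ⁻¹ j)`. -/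
def permAct {k : ℕ} (σ : Equiv.Perm (Fin k)) (M : Matrix (Fin k) (Fin k) (ZMod 2)) :
    Matrix (Fin k) (Fin k) (ZMod 2) :=
  M.submatrix ⇑σ⁻¹ ⇑σ⁻¹

theorem apply_eq_zero_of_notMem_essential {k : ℕ} {M : Matrix (Fin k) (Fin k) (ZMod 2)}
    {i j : Fin k} (hi : i ∉ essential M) (hij : j ≠ i) : M i j = 0 ∧ M j i = 0 := by
  have eq_zero_of_ne_one : ∀ x : ZMod 2, x ≠ 1 → x = 0 := by decide
  exact ⟨eq_zero_of_ne_one _ fun h => hi ⟨j, hij, .inl h⟩,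
    eq_zero_of_ne_one _ fun h => hi ⟨j, hij, .inr h⟩⟩

theorem apply_self_eq_one_of_notMem_essential {k : ℕ} (N : GL (Fin k) (ZMod 2)) {i : Fin k}
    (hi : i ∉ essential (N : Matrix (Fin k) (Fin k) (ZMod 2))) : N.1 i i = 1 := by
  have eq_one_of_ne_zero : ∀ x : ZMod 2, x ≠ 0 → x = 1 := by decide
  refine eq_one_of_ne_zero _ fun h => ?_
  have hrow : ∀ j, N.1 i j = 0 := fun j => by
    by_cases hj : j = i
    · rw [hj, h]
    · exact (apply_eq_zero_of_notMem_essential hi hj).1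
  have hinv := congrFun (congrFun N.mul_inv i) i
  simp [Matrix.mul_apply, hrow] at hinv

/-- Restricting an invertible matrix to an index set containing its essential indices gives an
invertible matrix. -/
theorem exists_GL_eq_submatrix {m n : ℕ} (N : GL (Fin n) (ZMod 2)) {f : Fin m → Fin n}
    (hf : Function.Injective f)
    (hess : essential (N : Matrix (Fin n) (Fin n) (ZMod 2)) ⊆ Set.range f) :
    ∃ M : GL (Fin m) (ZMod 2), M.1 = N.1.submatrix f f := by
  have hmul : N.1.submatrix f f * (N⁻¹).1.submatrix f f = 1 := by
    ext i j
    have hinv := congrFun (congrFun N.mul_inv (f i)) (f j)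
    rw [Matrix.mul_apply] at hinv ⊢
    rw [Matrix.one_apply, ← if_congr (hf.eq_iff (a := i) (b := j)) rfl rfl, ← Matrix.one_apply,
      ← hinv]
    refine Fintype.sum_of_injective f hf _ _ (fun x hx => ?_) fun _ => rfl
    rw [(apply_eq_zero_of_notMem_essential (mt (@hess x) hx) fun h => hx ⟨i, h⟩).2, zero_mul]
  exact ⟨⟨_, _, hmul, mul_eq_one_comm.mp hmul⟩, rfl⟩

/-- A set of `m` indices is the image of the first `m` indices under some permutation. -/
theorem exists_perm_mem_iff_lt {m n : ℕ} (hm : m ≤ n) {s : Set (Fin n)} (hs : s.ncard = m) :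
    ∃ τ : Equiv.Perm (Fin n), ∀ x, τ x ∈ s ↔ (x : ℕ) < m := by
  classical
  have hcard : Fintype.card {x : Fin n // (x : ℕ) < m} = Fintype.card {x // x ∈ s} := by
    rw [Fintype.card_fin_lt_of_le hm, ← Nat.card_eq_fintype_card (α := s)]
    exact hs.symm
  let e := Fintype.equivOfCardEq hcard
  exact ⟨e.extendSubtype, fun x => ⟨fun h => by_contra fun hx => e.extendSubtype_not_mem x hx h,
    e.extendSubtype_mem x⟩⟩

theorem canonical_representative (n m : ℕ) (hm : m ≤ n) (N : GL (Fin n) (ZMod 2))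
    (hcard : (essential (N : Matrix (Fin n) (Fin n) (ZMod 2))).ncard = m) :
    ∃ (M : GL (Fin m) (ZMod 2)) (σ : Equiv.Perm (Fin n)),
      embedMat m n (M : Matrix (Fin m) (Fin m) (ZMod 2))
        = permAct σ (N : Matrix (Fin n) (Fin n) (ZMod 2)) := by
  obtain ⟨τ, hτ⟩ := exists_perm_mem_iff_lt hm hcard
  obtain ⟨M, hM⟩ := exists_GL_eq_submatrix N (f := τ ∘ Fin.castLE hm)
    (τ.injective.comp (Fin.castLE_injective hm)) fun x hx =>
      ⟨⟨τ.symm x, (hτ _).mp (by simpa using hx)⟩, by simp⟩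
  refine ⟨M, τ⁻¹, ?_⟩
  ext i j
  have hzero (a b : Fin n) (ha : ¬ (a : ℕ) < m) (hab : b ≠ a) :=
    apply_eq_zero_of_notMem_essential (mt (hτ a).mp ha) (τ.injective.ne hab)
  simp only [embedMat, permAct, inv_inv, Matrix.submatrix_apply, hM]
  split_ifs with hi hj hij
  · rfl
  · exact (hzero j i hj fun h => hj (h ▸ hi)).2.symm
  · rw [← hij, apply_self_eq_one_of_notMem_essential N (mt (hτ i).mp hi)]
  · exact (hzero i j hi (Ne.symm hij)).1.symm
end

section
/- Let N ∈ GL(n,2) and let T_{i₁,j₁}, T_{i₂,j₂}, …, T_{iₖ,jₖ} be any finite sequence of transvections whose product equals N. Then every essential index of N appears among the indices used by the sequence, i.e., ε(N) ⊆ ⋃_{t=1}^{k} {i_t, j_t}. -/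
/-- A product of transvections that avoid the index `i` agrees with the identity matrix
on row `i` and column `i`. -/
theorem prod_transvection_apply_of_unused {ι R : Type*} [Fintype ι] [DecidableEq ι] [CommRing R]
    (c : R) (i : ι) (L : List (ι × ι)) (hi : ∀ p ∈ L, i ≠ p.1 ∧ i ≠ p.2) (j : ι) :
    (L.map fun p => Matrix.transvection p.1 p.2 c).prod i j = (1 : Matrix ι ι R) i j ∧
      (L.map fun p => Matrix.transvection p.1 p.2 c).prod j i = (1 : Matrix ι ι R) j i := by
  induction L generalizing j with
  | nil => simp
  | cons p L ih =>
    obtain ⟨h₁, h₂⟩ := hi p List.mem_cons_self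
    have ih' := ih fun q hq => hi q (List.mem_cons_of_mem _ hq)
    rw [List.map_cons, List.prod_cons]
    refine ⟨?_, ?_⟩
    · rw [Matrix.transvection_mul_apply_of_ne _ _ _ _ h₁]
      exact (ih' j).1
    · by_cases hj : j = p.1
      · subst hj
        rw [Matrix.transvection_mul_apply_same, (ih' _).2, (ih' _).2,
          Matrix.one_apply_ne h₂.symm, mul_zero, add_zero]
      · rw [Matrix.transvection_mul_apply_of_ne _ _ _ _ hj]
        exact (ih' j).2

theorem essential_indices_are_necessary (n : ℕ) (N : GL (Fin n) (ZMod 2))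
    (L : List (Fin n × Fin n)) (hL : ∀ p ∈ L, p.1 ≠ p.2)
    (hprod : (L.map fun p => Matrix.transvection p.1 p.2 (1 : ZMod 2)).prod
      = (N : Matrix (Fin n) (Fin n) (ZMod 2))) :
    essential (N : Matrix (Fin n) (Fin n) (ZMod 2))
      ⊆ {i | ∃ p ∈ L, i = p.1 ∨ i = p.2} := by
  rintro i ⟨j, hji, hN⟩
  by_contra h
  simp only [Set.mem_ofPred_eq, not_exists, not_and, not_or] at h
  obtain ⟨hrow, hcol⟩ := prod_transvection_apply_of_unused (1 : ZMod 2) i L h j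
  rw [hprod] at hrow hcol
  rw [hrow, hcol, Matrix.one_apply_ne hji.symm, Matrix.one_apply_ne hji] at hN
  simp at hN
end

section
/- For every N ∈ GL(n,2), the number of essential indices of N is at most twice its transvection word length: |ε(N)| ≤ 2·δ(N). -/
/-- The word length of `g` with respect to a set `S`: the least `k` such that
`g` is a product of `k` elements of `S`. -/
noncomputable def wordLen {G : Type*} [Monoid G] (S : Set G) (g : G) : ℕ :=
  sInf {k | ∃ l : List G, (∀ x ∈ l, x ∈ S) ∧ l.length = k ∧ l.prod = g}

/-- The set of transvection matrices `T i j = 1 + E i j` (for `i ≠ j`) over `𝔽₂`. -/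
def Tmats (n : ℕ) : Set (Matrix (Fin n) (Fin n) (ZMod 2)) :=
  {A | ∃ i j : Fin n, i ≠ j ∧ A = Matrix.transvection i j 1}

/-- The word length is realised by a word as soon as `g` lies in the submonoid generated by `S`. -/
theorem exists_list_length_eq_wordLen {G : Type*} [Monoid G] {S : Set G} {g : G}
    (hg : g ∈ Submonoid.closure S) :
    ∃ l : List G, (∀ x ∈ l, x ∈ S) ∧ l.length = wordLen S g ∧ l.prod = g := by
  obtain ⟨l, hl, hprod⟩ := Submonoid.exists_list_of_mem_closure hg
  exact Nat.sInf_mem (s := {k | ∃ l : List G, (∀ x ∈ l, x ∈ S) ∧ l.length = k ∧ l.prod = g})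
    ⟨l.length, l, hl, rfl, hprod⟩

theorem ZMod.eq_zero_or_eq_one_of_two (c : ZMod 2) : c = 0 ∨ c = 1 := by
  revert c; decide

theorem toMatrix_mem_closure_Tmats {n : ℕ} (t : Matrix.TransvectionStruct (Fin n) (ZMod 2)) :
    t.toMatrix ∈ Submonoid.closure (Tmats n) := by
  obtain ⟨i, j, hij, c⟩ := t
  rcases ZMod.eq_zero_or_eq_one_of_two c with rfl | rfl
  · simp [Matrix.TransvectionStruct.toMatrix]
  · exact Submonoid.subset_closure ⟨i, j, hij, rfl⟩

/-- The transvections generate the invertible matrices over `𝔽₂`. -/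
theorem coe_GL_mem_closure_Tmats {n : ℕ} (N : GL (Fin n) (ZMod 2)) :
    (N : Matrix (Fin n) (Fin n) (ZMod 2)) ∈ Submonoid.closure (Tmats n) := by
  obtain ⟨L, L', D, hN⟩ :=
    Matrix.Pivot.exists_list_transvec_mul_diagonal_mul_list_transvec
      (N : Matrix (Fin n) (Fin n) (ZMod 2))
  have hdet : (N : Matrix (Fin n) (Fin n) (ZMod 2)).det ≠ 0 :=
    ((Matrix.isUnit_iff_isUnit_det _).1 N.isUnit).ne_zero
  have hprod : ∏ i, D i ≠ 0 := by
    intro h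
    apply hdet
    rw [hN, Matrix.det_mul, Matrix.det_mul, Matrix.det_diagonal, h, mul_zero, zero_mul]
  have hD : D = fun _ => 1 := by
    funext i
    exact (ZMod.eq_zero_or_eq_one_of_two (D i)).resolve_left
      (Finset.prod_ne_zero_iff.1 hprod i (Finset.mem_univ i))
  have hlist (l : List (Matrix.TransvectionStruct (Fin n) (ZMod 2))) :
      (l.map Matrix.TransvectionStruct.toMatrix).prod ∈ Submonoid.closure (Tmats n) := by
    apply Submonoid.list_prod_mem
    intro x hx
    obtain ⟨t, -, rfl⟩ := List.mem_map.1 hx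
    exact toMatrix_mem_closure_Tmats t
  rw [hN, hD, Matrix.diagonal_one, mul_one]
  exact mul_mem (hlist L) (hlist L')

/-- A product of `k` transvections agrees with the identity outside a block of size at most
`2 * k`. -/
theorem exists_finset_prod_apply_eq_one_apply {n : ℕ}
    (l : List (Matrix (Fin n) (Fin n) (ZMod 2))) (hl : ∀ x ∈ l, x ∈ Tmats n) :
    ∃ s : Finset (Fin n), s.card ≤ 2 * l.length ∧
      ∀ a b, a ∉ s ∨ b ∉ s → l.prod a b = (1 : Matrix (Fin n) (Fin n) (ZMod 2)) a b := by
  induction l with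
  | nil => exact ⟨∅, by simp⟩
  | cons x l ih =>
    obtain ⟨s, hcard, hs⟩ := ih fun y hy => hl y (List.mem_cons_of_mem _ hy)
    obtain ⟨i, j, -, rfl⟩ := hl x List.mem_cons_self
    refine ⟨insert i (insert j s), ?_, fun a b hab => ?_⟩
    · have h₁ := Finset.card_insert_le i (insert j s)
      have h₂ := Finset.card_insert_le j s
      rw [List.length_cons]
      omega
    · simp only [Finset.mem_insert, not_or] at hab
      rw [List.prod_cons]
      by_cases ha : a = i
      · subst ha
        obtain ⟨-, hbj, hbs⟩ := hab.resolve_left fun h => h.1 rfl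
        rw [Matrix.transvection_mul_apply_same, hs a b (.inr hbs), hs j b (.inr hbs),
          Matrix.one_apply_ne (Ne.symm hbj), mul_zero, add_zero]
      · rw [Matrix.transvection_mul_apply_of_ne _ _ _ _ ha]
        exact hs a b (hab.imp (fun h => h.2.2) fun h => h.2.2)

theorem essential_subset_of_apply_eq_one_apply {n : ℕ} {M : Matrix (Fin n) (Fin n) (ZMod 2)}
    {s : Finset (Fin n)}
    (hs : ∀ a b, a ∉ s ∨ b ∉ s → M a b = (1 : Matrix (Fin n) (Fin n) (ZMod 2)) a b) :
    essential M ⊆ s := by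
  rintro i ⟨j, hji, h⟩
  by_contra hi
  rw [Finset.mem_coe] at hi
  rw [hs i j (.inl hi), hs j i (.inr hi), Matrix.one_apply_ne hji, Matrix.one_apply_ne hji.symm,
    or_self] at h
  exact zero_ne_one h

theorem essential_indices_at_distance (n : ℕ) (N : GL (Fin n) (ZMod 2)) :
    (essential (N : Matrix (Fin n) (Fin n) (ZMod 2))).ncard
      ≤ 2 * wordLen (Tmats n) (N : Matrix (Fin n) (Fin n) (ZMod 2)) := by
  obtain ⟨l, hl, hlen, hprod⟩ := exists_list_length_eq_wordLen (coe_GL_mem_closure_Tmats N)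
  obtain ⟨s, hcard, hs⟩ := exists_finset_prod_apply_eq_one_apply l hl
  rw [← hlen, ← hprod]
  exact (Set.ncard_le_ncard (essential_subset_of_apply_eq_one_apply hs) s.finite_toSet).trans
    (by rwa [Set.ncard_coe_finset])
end

section
/- For every natural number d ≥ 1 there exists a matrix M ∈ GL(2d,2) with transvection word length δ(M) = d whose set of essential indices is all of {1,…,2d}, i.e., |ε(M)| = 2d. (Consequently the polynomial expressing |R_n(d)| for n ≥ 2d has degree exactly 2d.) -/
theorem essential_mul_subset {k : ℕ} (A B : Matrix (Fin k) (Fin k) (ZMod 2)) :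
    essential (A * B) ⊆ essential A ∪ essential B := by
  have key (x : ZMod 2) (hx : x ≠ 0) : x = 1 := by
    revert x
    decide
  have entry (i j : Fin k) (h : (A * B) i j = 1) : ∃ m, A i m = 1 ∧ B m j = 1 := by
    rw [Matrix.mul_apply] at h
    obtain ⟨m, -, hm⟩ := Finset.exists_ne_zero_of_sum_ne_zero (h.trans_ne one_ne_zero)
    exact ⟨m, key _ (left_ne_zero_of_mul hm), key _ (right_ne_zero_of_mul hm)⟩
  rintro i ⟨j, hj, h | h⟩ <;> obtain ⟨m, hA, hB⟩ := entry _ _ h <;> by_cases hm : m = i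
  · exact Or.inr ⟨j, hj, Or.inl (hm ▸ hB)⟩
  · exact Or.inl ⟨m, hm, Or.inl hA⟩
  · exact Or.inl ⟨j, hj, Or.inr (hm ▸ hA)⟩
  · exact Or.inr ⟨m, hm, Or.inr hB⟩

theorem essential_one (k : ℕ) : essential (1 : Matrix (Fin k) (Fin k) (ZMod 2)) = ∅ := by
  refine Set.eq_empty_of_forall_notMem ?_
  rintro i ⟨j, hj, h | h⟩
  · simp [Matrix.one_apply_ne hj.symm] at h
  · simp [Matrix.one_apply_ne hj] at h

theorem essential_transvection_subset {k : ℕ} (p q : Fin k) :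
    essential (Matrix.transvection p q (1 : ZMod 2)) ⊆ {p, q} := by
  rintro i ⟨j, hj, h⟩
  simp only [Matrix.transvection, Matrix.add_apply, Matrix.one_apply_ne hj,
    Matrix.one_apply_ne hj.symm, Matrix.single_apply] at h
  grind

theorem ncard_essential_list_prod_le {k : ℕ} (l : List (Matrix (Fin k) (Fin k) (ZMod 2)))
    (hl : ∀ x ∈ l, x ∈ Tmats k) : (essential l.prod).ncard ≤ 2 * l.length := by
  induction l with
  | nil => simp [essential_one]
  | cons A l ih =>
    obtain ⟨p, q, -, hA⟩ := hl A (by simp)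
    have hsub : essential (A :: l).prod ⊆ {p, q} ∪ essential l.prod := by
      rw [List.prod_cons, hA]
      exact (essential_mul_subset _ _).trans
        (Set.union_subset_union_left _ (essential_transvection_subset p q))
    have hcard := (Set.ncard_le_ncard hsub (Set.toFinite _)).trans (Set.ncard_union_le _ _)
    have hpair := Set.ncard_insert_le p {q}
    rw [Set.ncard_singleton] at hpair
    have htail := ih fun x hx => hl x (List.mem_cons_of_mem _ hx)
    rw [List.length_cons]
    omega

theorem list_prod_transvection_eq_one_add_sum {ι n R : Type*} [DecidableEq n] [Fintype n]
    [CommRing R] (f g : ι → n) (hfg : ∀ i j, g i ≠ f j) (l : List ι) :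
    (l.map fun i => Matrix.transvection (f i) (g i) (1 : R)).prod =
      1 + (l.map fun i => Matrix.single (f i) (g i) (1 : R)).sum := by
  induction l with
  | nil => simp
  | cons i l ih =>
    have hzero : Matrix.single (f i) (g i) (1 : R) *
        (l.map fun i => Matrix.single (f i) (g i) (1 : R)).sum = 0 := by
      rw [← List.sum_map_mul_left]
      refine List.sum_eq_zero fun x hx => ?_
      obtain ⟨j, -, rfl⟩ := List.mem_map.1 hx
      exact Matrix.single_mul_single_of_ne _ _ _ _ (hfg i j) _
    rw [List.map_cons, List.prod_cons, ih, List.map_cons, List.sum_cons, Matrix.transvection,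
      add_mul, mul_add, mul_add, hzero, one_mul, one_mul, mul_one, add_zero]
    abel

theorem exists_matrix_with_all_indices_essential (d : ℕ) (hd : 1 ≤ d) :
    ∃ M : GL (Fin (2 * d)) (ZMod 2),
      wordLen (Tmats (2 * d)) (M : Matrix (Fin (2 * d)) (Fin (2 * d)) (ZMod 2)) = d ∧
      essential (M : Matrix (Fin (2 * d)) (Fin (2 * d)) (ZMod 2)) = Set.univ := by
  let f : Fin d → Fin (2 * d) := fun i => ⟨i, by omega⟩
  let g : Fin d → Fin (2 * d) := fun i => ⟨d + i, by omega⟩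
  have hgf (i j : Fin d) : g i ≠ f j := by
    simp only [f, g, ne_eq, Fin.mk.injEq]
    omega
  let l := (List.finRange d).map fun i => Matrix.transvection (f i) (g i) (1 : ZMod 2)
  have hlT : ∀ x ∈ l, x ∈ Tmats (2 * d) := by
    intro x hx
    obtain ⟨i, -, rfl⟩ := List.mem_map.1 hx
    exact ⟨f i, g i, (hgf i i).symm, rfl⟩
  have hlen : l.length = d := by simp [l]
  have hunit : IsUnit l.prod := by
    refine (IsUnit.submonoid _).list_prod_mem fun x hx => ?_
    obtain ⟨i, j, hij, rfl⟩ := hlT x hx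
    refine (Matrix.isUnit_iff_isUnit_det _).2 ?_
    rw [Matrix.det_transvection_of_ne i j hij]
    exact isUnit_one
  have hentry (i : Fin d) : l.prod (f i) (g i) = 1 := by
    have hfinj (j : Fin d) : f j = f i ↔ j = i := by simp [f, Fin.ext_iff]
    have hginj (j : Fin d) : g j = g i ↔ j = i := by simp [g, Fin.ext_iff]
    simp only [l]
    rw [list_prod_transvection_eq_one_add_sum f g hgf, ← List.ofFn_eq_map, List.sum_ofFn,
      Matrix.add_apply, Matrix.one_apply_ne (hgf i i).symm, Matrix.sum_apply]
    simp [Matrix.single_apply, hfinj, hginj]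
  have hess : essential l.prod = Set.univ := by
    refine Set.eq_univ_of_forall fun a => ?_
    by_cases ha : (a : ℕ) < d
    · exact ⟨g ⟨a, ha⟩, hgf _ ⟨a, ha⟩, Or.inl (hentry ⟨a, ha⟩)⟩
    · have hag : a = g ⟨a - d, by omega⟩ := by
        simp only [g, Fin.ext_iff]
        omega
      rw [hag]
      exact ⟨f _, (hgf _ _).symm, Or.inr (hentry _)⟩
  refine ⟨hunit.unit, ?_, hess⟩
  rw [IsUnit.unit_spec]
  refine le_antisymm (Nat.sInf_le ⟨l, hlT, hlen, rfl⟩)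
    (le_csInf ⟨d, l, hlT, hlen, rfl⟩ ?_)
  rintro k ⟨l', hl', rfl, hprod⟩
  have hle := ncard_essential_list_prod_le l' hl'
  rw [hprod, hess, Set.ncard_univ, Nat.card_fin] at hle
  omega
end
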